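/- arXiv:1610.04509 — 6 statements merged into one kernel-verified Lean document; each statement's English description precedes it below -/
import Mathlib

section
/- (Global relation.) Let L > 0, T > 0 and let q : ℝ × ℝ → ℂ be smooth and satisfy q_t + q_{xxx} = 0 at every point of [0,L] × [0,T]. Then for every k ∈ ℂ and every t ∈ [0,T]: e^{-ik³ t} ∫₀ᴸ e^{-ikx} q(x,t) dx = ∫₀ᵗ e^{-ikL - ik³ s} X(L,s,k) ds − ∫₀ᵗ e^{-ik³ s} X(0,s,k) ds + ∫₀ᴸ e^{-ikx} q(x,0) dx, where X(x,s,k) = k² q(x,s) − i k q_x(x,s) − q_{xx}(x,s). -/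
open Complex

lemma gr_aux (f : ℝ × ℝ → ℂ) (hf : ContDiff ℝ (⊤ : ℕ∞) f) :
    ∃ g : ℝ × ℝ → ℂ, ContDiff ℝ (⊤ : ℕ∞) g ∧
      ∀ x s, HasDerivAt (fun z : ℝ => f (z, s)) (g (x, s)) x := by
  refine ⟨fun p => fderiv ℝ f p (1, 0), ?_, ?_⟩
  · exact (hf.fderiv_right (m := (⊤ : ℕ∞)) (by simp)).clm_apply contDiff_const
  · intro x s
    have h := (hf.differentiable (by simp) (x, s)).hasFDerivAt
    exact h.comp_hasDerivAt x ((hasDerivAt_id x).prodMk (hasDerivAt_const x s))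

theorem global_relation (L T : ℝ) (hL : 0 < L) (hT : 0 < T) (q : ℝ × ℝ → ℂ)
    (hq : ContDiff ℝ (⊤ : ℕ∞) q)
    (hpde : ∀ x ∈ Set.Icc (0 : ℝ) L, ∀ s ∈ Set.Icc (0 : ℝ) T,
      deriv (fun s' : ℝ => q (x, s')) s
        + deriv (deriv (deriv (fun z : ℝ => q (z, s)))) x = 0)
    (k : ℂ) (t : ℝ) (ht : t ∈ Set.Icc (0 : ℝ) T) :
    Complex.exp (-(I * k ^ 3 * (t : ℂ))) * ∫ x in (0:ℝ)..L, Complex.exp (-(I * k * (x : ℂ))) * q (x, t)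
      = (∫ s in (0:ℝ)..t, Complex.exp (-(I * k * (L : ℂ)) - I * k ^ 3 * (s : ℂ)) *
            (k ^ 2 * q (L, s) - I * k * deriv (fun z : ℝ => q (z, s)) L
              - deriv (deriv (fun z : ℝ => q (z, s))) L))
        - (∫ s in (0:ℝ)..t, Complex.exp (-(I * k ^ 3 * (s : ℂ))) *
            (k ^ 2 * q (0, s) - I * k * deriv (fun z : ℝ => q (z, s)) 0
              - deriv (deriv (fun z : ℝ => q (z, s))) 0))
        + ∫ x in (0:ℝ)..L, Complex.exp (-(I * k * (x : ℂ))) * q (x, 0) := by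
  obtain ⟨q1, hq1, h1⟩ := gr_aux q hq
  obtain ⟨q2, hq2, h2⟩ := gr_aux q1 hq1
  obtain ⟨q3, hq3, h3⟩ := gr_aux q2 hq2
  have d1 : ∀ s, deriv (fun z : ℝ => q (z, s)) = fun z => q1 (z, s) :=
    fun s => funext fun x => (h1 x s).deriv
  have d2 : ∀ s, deriv (fun z : ℝ => q1 (z, s)) = fun z => q2 (z, s) :=
    fun s => funext fun x => (h2 x s).deriv
  have d3 : ∀ s, deriv (fun z : ℝ => q2 (z, s)) = fun z => q3 (z, s) :=
    fun s => funext fun x => (h3 x s).deriv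
  simp only [d1, d2, d3] at hpde ⊢
  have c0 := hq.continuous
  have c1 := hq1.continuous
  have c2 := hq2.continuous
  have c3 := hq3.continuous
  have ht0 : ∀ s ∈ Set.uIcc 0 t, s ∈ Set.Icc (0:ℝ) T := by
    intro s hs
    rw [Set.uIcc_of_le ht.1] at hs
    exact ⟨hs.1, hs.2.trans ht.2⟩
  have hLx : ∀ x ∈ Set.uIcc 0 L, x ∈ Set.Icc (0:ℝ) L := by
    intro x hx
    rwa [Set.uIcc_of_le hL.le] at hx
  let E : ℝ → ℝ → ℂ := fun x s => Complex.exp (-(I * k * (x : ℂ)) - I * k ^ 3 * (s : ℂ))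
  let H : ℝ → ℝ → ℂ := fun x s => E x s * (-(I * k ^ 3) * q (x, s) - q3 (x, s))
  have hH : Continuous (Function.uncurry H) := by
    simp only [H, E, Function.uncurry_def]
    fun_prop
  have Es : ∀ x s, HasDerivAt (fun s => E x s) (E x s * (-(I * k ^ 3))) s := by
    intro x s
    have h : HasDerivAt (fun s : ℝ => (s : ℂ)) 1 s := Complex.ofRealCLM.hasDerivAt
    have := ((h.const_mul (I * k ^ 3)).const_sub (-(I * k * (x : ℂ)))).cexp
    simpa [E] using this
  have Ex : ∀ x s, HasDerivAt (fun x => E x s) (E x s * (-(I * k))) x := by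
    intro x s
    have h : HasDerivAt (fun s : ℝ => (s : ℂ)) 1 x := Complex.ofRealCLM.hasDerivAt
    have := (((h.const_mul (I * k)).neg).sub_const (I * k ^ 3 * (s : ℂ))).cexp
    simpa [E] using this
  have A : ∀ x ∈ Set.uIcc 0 L, ∫ s in (0:ℝ)..t, H x s = E x t * q (x, t) - E x 0 * q (x, 0) := by
    intro x hx
    refine intervalIntegral.integral_eq_sub_of_hasDerivAt
      (f := fun s => E x s * q (x, s)) ?_ ?_
    · intro s hs
      have hd : HasDerivAt (fun s' : ℝ => q (x, s')) (-q3 (x, s)) s := by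
        have hdiff : DifferentiableAt ℝ (fun s' : ℝ => q (x, s')) s :=
          (hq.differentiable (by simp) (x, s)).comp s
            ((differentiableAt_const x).prodMk differentiableAt_id)
        have := hdiff.hasDerivAt
        rwa [eq_neg_of_add_eq_zero_left (hpde x (hLx x hx) s (ht0 s hs))] at this
      refine ((Es x s).mul hd).congr_deriv ?_
      simp only [H]; ring
    · exact (hH.comp (by fun_prop : Continuous fun s : ℝ => (x, s))).intervalIntegrable _ _
  have B : ∀ s, ∫ x in (0:ℝ)..L, H x s =
      E L s * (k ^ 2 * q (L, s) - I * k * q1 (L, s) - q2 (L, s)) -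
      E 0 s * (k ^ 2 * q (0, s) - I * k * q1 (0, s) - q2 (0, s)) := by
    intro s
    refine intervalIntegral.integral_eq_sub_of_hasDerivAt
      (f := fun x => E x s * (k ^ 2 * q (x, s) - I * k * q1 (x, s) - q2 (x, s))) ?_ ?_
    · intro x _
      refine ((Ex x s).mul ((((h1 x s).const_mul (k ^ 2)).sub
        ((h2 x s).const_mul (I * k))).sub (h3 x s))).congr_deriv ?_
      simp only [H, Pi.sub_apply]
      linear_combination (E x s * k ^ 2 * q1 (x, s)) * I_sq
    · exact (hH.comp (by fun_prop : Continuous fun x : ℝ => (x, s))).intervalIntegrable _ _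
  have S : ∫ x in (0:ℝ)..L, ∫ s in (0:ℝ)..t, H x s = ∫ s in (0:ℝ)..t, ∫ x in (0:ℝ)..L, H x s := by
    apply MeasureTheory.intervalIntegral_intervalIntegral_swap
    refine (hH.continuousOn.integrableOn_compact
      (isCompact_uIcc.prod isCompact_uIcc)).mono_set
      (Set.prod_mono Set.uIoc_subset_uIcc Set.uIoc_subset_uIcc)
  rw [intervalIntegral.integral_congr A] at S
  simp only [B] at S
  rw [intervalIntegral.integral_sub, intervalIntegral.integral_sub] at S
  · have e1 : ∀ x, E x t = Complex.exp (-(I * k ^ 3 * (t : ℂ))) * Complex.exp (-(I * k * (x : ℂ))) := by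
      intro x
      simp only [E]
      rw [← Complex.exp_add]; congr 1; ring
    have e2 : ∀ x, E x 0 = Complex.exp (-(I * k * (x : ℂ))) := by
      intro x
      simp [E]
    have e3 : ∀ s, E 0 s = Complex.exp (-(I * k ^ 3 * (s : ℂ))) := by
      intro s
      simp [E]
    simp only [e1, e2, e3, mul_assoc (Complex.exp (-(I * k ^ 3 * (t : ℂ)))),
      intervalIntegral.integral_const_mul] at S
    rw [← sub_eq_iff_eq_add]
    exact S
  all_goals
    apply Continuous.intervalIntegrable
    simp only [E]
    fun_prop
end

section
/- Let L > 0, T > 0 and let q : ℝ × ℝ → ℂ be smooth and satisfy q_t + q_{xxx} = 0 at every point of [0,L] × [0,T]. For t ∈ [0,T] and k ∈ ℂ define the spectral functions q̂(k,t) = ∫₀ᴸ e^{-ikx} q(x,t) dx, q̂₀(k) = ∫₀ᴸ e^{-ikx} q(x,0) dx, f̃ⱼ(k,t) = ∫₀ᵗ e^{-ik³ s} (∂_x^j q)(0,s) ds and g̃ⱼ(k,t) = ∫₀ᵗ e^{-ik³ s} (∂_x^j q)(L,s) ds for j = 0,1,2. Then for every k ∈ ℂ and t ∈ [0,T] the following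 three equations hold, where τ = e^{2πi/3}: (k² f̃₀ − i k f̃₁ − f̃₂) − e^{-ikL} (k² g̃₀ − i k g̃₁ − g̃₂) = q̂₀(k) − e^{-ik³ t} q̂(k,t); (τ² k² f̃₀ − i τ k f̃₁ − f̃₂) − e^{-iτkL} (τ² k² g̃₀ − i τ k g̃₁ − g̃₂) = q̂₀(τ k) − e^{-ik³ t} q̂(τ k,t); and (τ⁴ k² f̃₀ − i τ² k f̃₁ − f̃₂) − e^{-iτ²kL} (τ⁴ k² g̃₀ − i τ² k g̃₁ − g̃₂) = q̂₀(τ² k) − e^{-ik³ t} q̂(τ² k,t). (All f̃ⱼ, g̃ⱼ are evaluated at (k,t); they are unchanged under k ↦ τk since (τk)³ = k³.) -/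
open Complex

/-- Finite-interval Fourier transform of `q(·,t)` on `[0,L]`. -/
noncomputable def qhat (q : ℝ × ℝ → ℂ) (L : ℝ) (k : ℂ) (t : ℝ) : ℂ :=
  ∫ x in (0:ℝ)..L, Complex.exp (-(I * k * (x : ℂ))) * q (x, t)

/-- Time transform of the `j`-th spatial derivative of `q` at `x = a`. -/
noncomputable def bdryTransform (q : ℝ × ℝ → ℂ) (a : ℝ) (j : ℕ) (k : ℂ) (t : ℝ) : ℂ :=
  ∫ s in (0:ℝ)..t, Complex.exp (-(I * k ^ 3 * (s : ℂ))) * (deriv^[j] (fun z : ℝ => q (z, s))) a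

lemma aux_hasDerivAt_x (q : ℝ × ℝ → ℂ) (hq : ContDiff ℝ (⊤ : ℕ∞) q) (x s : ℝ) :
    HasDerivAt (fun z : ℝ => q (z, s)) (fderiv ℝ q (x, s) (1, 0)) x := by
  have h1 : HasFDerivAt q (fderiv ℝ q (x, s)) (x, s) :=
    (hq.differentiable (by simp) (x, s)).hasFDerivAt
  have h2 : HasDerivAt (fun z : ℝ => (z, s)) ((1 : ℝ), (0 : ℝ)) x :=
    (hasDerivAt_id x).prodMk (hasDerivAt_const x s)
  exact h1.comp_hasDerivAt x h2

lemma aux_hasDerivAt_t (q : ℝ × ℝ → ℂ) (hq : ContDiff ℝ (⊤ : ℕ∞) q) (x s : ℝ) :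
    HasDerivAt (fun z : ℝ => q (x, z)) (fderiv ℝ q (x, s) (0, 1)) s := by
  have h1 : HasFDerivAt q (fderiv ℝ q (x, s)) (x, s) :=
    (hq.differentiable (by simp) (x, s)).hasFDerivAt
  have h2 : HasDerivAt (fun z : ℝ => (x, z)) ((0 : ℝ), (1 : ℝ)) s :=
    (hasDerivAt_const s x).prodMk (hasDerivAt_id s)
  exact h1.comp_hasDerivAt s h2

lemma aux_contDiff (q : ℝ × ℝ → ℂ) (hq : ContDiff ℝ (⊤ : ℕ∞) q) (v : ℝ × ℝ) :
    ContDiff ℝ (⊤ : ℕ∞) (fun p => fderiv ℝ q p v) :=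
  (hq.fderiv_right (m := (⊤ : ℕ∞)) (by simp)).clm_apply contDiff_const

lemma aux_exp (c : ℂ) (x : ℝ) :
    HasDerivAt (fun x : ℝ => Complex.exp (-(c * (x : ℂ))))
      (Complex.exp (-(c * (x : ℂ))) * (-c)) x := by
  have h : HasDerivAt (fun x : ℝ => -(c * (x : ℂ))) (-c) x := by
    have h0 : HasDerivAt (fun x : ℝ => (x : ℂ)) 1 x := (hasDerivAt_id x).ofReal_comp
    have h1 : HasDerivAt (fun x : ℝ => -(c * (x : ℂ))) (-(c * 1)) x := (h0.const_mul c).neg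
    rwa [mul_one] at h1
  exact h.cexp

lemma aux_main (L T : ℝ) (hL : 0 < L) (q : ℝ × ℝ → ℂ)
    (hq : ContDiff ℝ (⊤ : ℕ∞) q)
    (hpde : ∀ x ∈ Set.Icc (0 : ℝ) L, ∀ s ∈ Set.Icc (0 : ℝ) T,
      deriv (fun s' : ℝ => q (x, s')) s
        + deriv (deriv (deriv (fun z : ℝ => q (z, s)))) x = 0)
    (k κ : ℂ) (hκ : κ ^ 3 = k ^ 3) (t : ℝ) (ht : t ∈ Set.Icc (0 : ℝ) T) :
    (κ ^ 2 * bdryTransform q 0 0 k t - I * κ * bdryTransform q 0 1 k t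
        - bdryTransform q 0 2 k t)
      - Complex.exp (-(I * κ * (L : ℂ))) * (κ ^ 2 * bdryTransform q L 0 k t
        - I * κ * bdryTransform q L 1 k t - bdryTransform q L 2 k t)
      = qhat q L κ 0 - Complex.exp (-(I * k ^ 3 * (t : ℂ))) * qhat q L κ t := by
  obtain ⟨q1, hq1⟩ : ∃ q1 : ℝ × ℝ → ℂ, q1 = fun p => fderiv ℝ q p (1, 0) := ⟨_, rfl⟩
  obtain ⟨q2, hq2⟩ : ∃ q2 : ℝ × ℝ → ℂ, q2 = fun p => fderiv ℝ q1 p (1, 0) := ⟨_, rfl⟩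
  obtain ⟨q3, hq3⟩ : ∃ q3 : ℝ × ℝ → ℂ, q3 = fun p => fderiv ℝ q2 p (1, 0) := ⟨_, rfl⟩
  obtain ⟨qt, hqt⟩ : ∃ qt : ℝ × ℝ → ℂ, qt = fun p => fderiv ℝ q p (0, 1) := ⟨_, rfl⟩
  have c1 : ContDiff ℝ (⊤ : ℕ∞) q1 := hq1 ▸ aux_contDiff q hq _
  have c2 : ContDiff ℝ (⊤ : ℕ∞) q2 := hq2 ▸ aux_contDiff q1 c1 _
  have c3 : ContDiff ℝ (⊤ : ℕ∞) q3 := hq3 ▸ aux_contDiff q2 c2 _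
  have ct : ContDiff ℝ (⊤ : ℕ∞) qt := hqt ▸ aux_contDiff q hq _
  have d0 : ∀ x s, HasDerivAt (fun z : ℝ => q (z, s)) (q1 (x, s)) x := fun x s => by
    rw [hq1]; exact aux_hasDerivAt_x q hq x s
  have d1 : ∀ x s, HasDerivAt (fun z : ℝ => q1 (z, s)) (q2 (x, s)) x := fun x s => by
    rw [hq2]; exact aux_hasDerivAt_x q1 c1 x s
  have d2 : ∀ x s, HasDerivAt (fun z : ℝ => q2 (z, s)) (q3 (x, s)) x := fun x s => by
    rw [hq3]; exact aux_hasDerivAt_x q2 c2 x s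
  have dt : ∀ x s, HasDerivAt (fun z : ℝ => q (x, z)) (qt (x, s)) s := fun x s => by
    rw [hqt]; exact aux_hasDerivAt_t q hq x s
  have e0 : ∀ s, deriv (fun z : ℝ => q (z, s)) = fun z => q1 (z, s) := fun s =>
    funext fun x => (d0 x s).deriv
  have e1 : ∀ s, deriv (fun z : ℝ => q1 (z, s)) = fun z => q2 (z, s) := fun s =>
    funext fun x => (d1 x s).deriv
  have pde : ∀ x ∈ Set.Icc (0 : ℝ) L, ∀ s ∈ Set.Icc (0 : ℝ) T, qt (x, s) + q3 (x, s) = 0 := by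
    intro x hx s hs
    have := hpde x hx s hs
    rwa [e0, e1, (d2 x s).deriv, (dt x s).deriv] at this
  have k0 := hq.continuous
  have k1 := c1.continuous
  have k2 := c2.continuous
  have k3 := c3.continuous
  have kt := ct.continuous
  clear hq1 hq2 hq3 hqt
  -- swap
  have swap : ∫ x in (0:ℝ)..L, ∫ s in (0:ℝ)..t,
        Complex.exp (-(I * κ * (x : ℂ))) * (Complex.exp (-(I * k ^ 3 * (s : ℂ))) *
          (-(I * k ^ 3)) * q (x, s) + Complex.exp (-(I * k ^ 3 * (s : ℂ))) * qt (x, s))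
      = ∫ s in (0:ℝ)..t, ∫ x in (0:ℝ)..L,
        Complex.exp (-(I * κ * (x : ℂ))) * (Complex.exp (-(I * k ^ 3 * (s : ℂ))) *
          (-(I * k ^ 3)) * q (x, s) + Complex.exp (-(I * k ^ 3 * (s : ℂ))) * qt (x, s)) := by
    apply MeasureTheory.intervalIntegral_intervalIntegral_swap
    have hc : Continuous (Function.uncurry fun (x s : ℝ) =>
        Complex.exp (-(I * κ * (x : ℂ))) * (Complex.exp (-(I * k ^ 3 * (s : ℂ))) *
          (-(I * k ^ 3)) * q (x, s) + Complex.exp (-(I * k ^ 3 * (s : ℂ))) * qt (x, s))) := by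
      simp only [Function.uncurry_def]
      fun_prop
    exact (hc.continuousOn.integrableOn_compact
      (isCompact_uIcc.prod isCompact_uIcc)).mono_set
      (Set.prod_mono Set.uIoc_subset_uIcc Set.uIoc_subset_uIcc)
  have lhs : ∀ x : ℝ, ∫ s in (0:ℝ)..t,
        Complex.exp (-(I * κ * (x : ℂ))) * (Complex.exp (-(I * k ^ 3 * (s : ℂ))) *
          (-(I * k ^ 3)) * q (x, s) + Complex.exp (-(I * k ^ 3 * (s : ℂ))) * qt (x, s))
      = Complex.exp (-(I * k ^ 3 * (t : ℂ))) * (Complex.exp (-(I * κ * (x : ℂ))) * q (x, t))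
        - Complex.exp (-(I * κ * (x : ℂ))) * q (x, 0) := by
    intro x
    rw [intervalIntegral.integral_eq_sub_of_hasDerivAt
      (f := fun s : ℝ => Complex.exp (-(I * κ * (x : ℂ))) *
        (Complex.exp (-(I * k ^ 3 * (s : ℂ))) * q (x, s)))
      (fun s _ => ((aux_exp (I * k ^ 3) s).mul (dt x s)).const_mul _)]
    · simp
      ring
    · apply Continuous.intervalIntegrable
      fun_prop
  have rhs : ∀ s ∈ Set.Icc (0 : ℝ) T, ∫ x in (0:ℝ)..L,
        Complex.exp (-(I * κ * (x : ℂ))) * (Complex.exp (-(I * k ^ 3 * (s : ℂ))) *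
          (-(I * k ^ 3)) * q (x, s) + Complex.exp (-(I * k ^ 3 * (s : ℂ))) * qt (x, s))
      = Complex.exp (-(I * κ * (L : ℂ))) *
          (κ ^ 2 * (Complex.exp (-(I * k ^ 3 * (s : ℂ))) * q (L, s))
          - I * κ * (Complex.exp (-(I * k ^ 3 * (s : ℂ))) * q1 (L, s))
          - (Complex.exp (-(I * k ^ 3 * (s : ℂ))) * q2 (L, s)))
        - (κ ^ 2 * (Complex.exp (-(I * k ^ 3 * (s : ℂ))) * q (0, s))
          - I * κ * (Complex.exp (-(I * k ^ 3 * (s : ℂ))) * q1 (0, s))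
          - (Complex.exp (-(I * k ^ 3 * (s : ℂ))) * q2 (0, s))) := by
    intro s hs
    rw [intervalIntegral.integral_eq_sub_of_hasDerivAt
      (f := fun x : ℝ => Complex.exp (-(I * κ * (x : ℂ))) *
          (κ ^ 2 * (Complex.exp (-(I * k ^ 3 * (s : ℂ))) * q (x, s))
          - I * κ * (Complex.exp (-(I * k ^ 3 * (s : ℂ))) * q1 (x, s))
          - (Complex.exp (-(I * k ^ 3 * (s : ℂ))) * q2 (x, s))))]
    · simp
    · intro x hx
      rw [Set.uIcc_of_le hL.le] at hx
      have hp : qt (x, s) = - q3 (x, s) := eq_neg_of_add_eq_zero_left (pde x hx s hs)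
      have hd := (aux_exp (I * κ) x).mul
        (((((d0 x s).const_mul (Complex.exp (-(I * k ^ 3 * (s : ℂ))))).const_mul (κ ^ 2)).sub
        (((d1 x s).const_mul (Complex.exp (-(I * k ^ 3 * (s : ℂ))))).const_mul (I * κ))).sub
        ((d2 x s).const_mul (Complex.exp (-(I * k ^ 3 * (s : ℂ))))))
      refine HasDerivAt.congr_deriv hd ?_
      symm
      rw [hp]
      generalize Complex.exp (-(I * k ^ 3 * (s : ℂ))) = E
      rw [← hκ]
      simp only [Pi.sub_apply]
      linear_combination (-Complex.exp (-(I * κ * (x : ℂ))) * E * κ ^ 2 * q1 (x, s)) * (I_sq)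
    · apply Continuous.intervalIntegrable
      fun_prop
  simp_rw [lhs] at swap
  have hrw := swap.trans (intervalIntegral.integral_congr (a := 0) (b := t)
    (g := fun s : ℝ => Complex.exp (-(I * κ * (L : ℂ))) *
          (κ ^ 2 * (Complex.exp (-(I * k ^ 3 * (s : ℂ))) * q (L, s))
          - I * κ * (Complex.exp (-(I * k ^ 3 * (s : ℂ))) * q1 (L, s))
          - (Complex.exp (-(I * k ^ 3 * (s : ℂ))) * q2 (L, s)))
        - (κ ^ 2 * (Complex.exp (-(I * k ^ 3 * (s : ℂ))) * q (0, s))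
          - I * κ * (Complex.exp (-(I * k ^ 3 * (s : ℂ))) * q1 (0, s))
          - (Complex.exp (-(I * k ^ 3 * (s : ℂ))) * q2 (0, s)))) (fun s hs => by
    rw [Set.uIcc_of_le ht.1] at hs
    exact rhs s ⟨hs.1, hs.2.trans ht.2⟩))
  clear swap
  rename' hrw => swap
  have ii : ∀ (f : ℝ × ℝ → ℂ) (a : ℝ), Continuous f → IntervalIntegrable
      (fun s : ℝ => Complex.exp (-(I * k ^ 3 * (s : ℂ))) * f (a, s)) MeasureTheory.volume 0 t :=
    fun f a hf => Continuous.intervalIntegrable (by fun_prop) _ _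
  have jj : ∀ a : ℝ, ∫ s in (0:ℝ)..t, (κ ^ 2 * (Complex.exp (-(I * k ^ 3 * (s : ℂ))) * q (a, s))
          - I * κ * (Complex.exp (-(I * k ^ 3 * (s : ℂ))) * q1 (a, s))
          - (Complex.exp (-(I * k ^ 3 * (s : ℂ))) * q2 (a, s))) =
      κ ^ 2 * bdryTransform q a 0 k t - I * κ * bdryTransform q a 1 k t
        - bdryTransform q a 2 k t := by
    intro a
    rw [intervalIntegral.integral_sub (((ii q a k0).const_mul _).sub ((ii q1 a k1).const_mul _))
        (ii q2 a k2),
      intervalIntegral.integral_sub ((ii q a k0).const_mul _) ((ii q1 a k1).const_mul _),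
      intervalIntegral.integral_const_mul, intervalIntegral.integral_const_mul]
    simp only [bdryTransform, Function.iterate_succ, Function.iterate_zero, Function.comp, id,
      e0, e1]
  have jc : ∀ a : ℝ, IntervalIntegrable (fun s : ℝ =>
      (κ ^ 2 * (Complex.exp (-(I * k ^ 3 * (s : ℂ))) * q (a, s))
          - I * κ * (Complex.exp (-(I * k ^ 3 * (s : ℂ))) * q1 (a, s))
          - (Complex.exp (-(I * k ^ 3 * (s : ℂ))) * q2 (a, s)))) MeasureTheory.volume 0 t :=
    fun a => (((ii q a k0).const_mul _).sub ((ii q1 a k1).const_mul _)).sub (ii q2 a k2)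
  have qi : ∀ s : ℝ, IntervalIntegrable
      (fun x : ℝ => Complex.exp (-(I * κ * (x : ℂ))) * q (x, s)) MeasureTheory.volume 0 L :=
    fun s => Continuous.intervalIntegrable (by fun_prop) _ _
  rw [intervalIntegral.integral_sub ((qi t).const_mul _) (qi 0),
    intervalIntegral.integral_sub ((jc L).const_mul _) (jc 0),
    intervalIntegral.integral_const_mul, intervalIntegral.integral_const_mul, jj, jj] at swap
  simp only [qhat]
  linear_combination swap

theorem global_relation_system (L T : ℝ) (hL : 0 < L) (hT : 0 < T) (q : ℝ × ℝ → ℂ)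
    (hq : ContDiff ℝ (⊤ : ℕ∞) q)
    (hpde : ∀ x ∈ Set.Icc (0 : ℝ) L, ∀ s ∈ Set.Icc (0 : ℝ) T,
      deriv (fun s' : ℝ => q (x, s')) s
        + deriv (deriv (deriv (fun z : ℝ => q (z, s)))) x = 0)
    (k : ℂ) (t : ℝ) (ht : t ∈ Set.Icc (0 : ℝ) T) :
    (((k ^ 2 * bdryTransform q 0 0 k t - I * k * bdryTransform q 0 1 k t
        - bdryTransform q 0 2 k t)
      - Complex.exp (-(I * k * (L : ℂ))) * (k ^ 2 * bdryTransform q L 0 k t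
        - I * k * bdryTransform q L 1 k t - bdryTransform q L 2 k t)
      = qhat q L k 0 - Complex.exp (-(I * k ^ 3 * (t : ℂ))) * qhat q L k t)
    ∧ (let τ : ℂ := Complex.exp (2 * (Real.pi : ℂ) * I / 3);
      (τ ^ 2 * k ^ 2 * bdryTransform q 0 0 k t - I * τ * k * bdryTransform q 0 1 k t
        - bdryTransform q 0 2 k t)
      - Complex.exp (-(I * τ * k * (L : ℂ))) * (τ ^ 2 * k ^ 2 * bdryTransform q L 0 k t
        - I * τ * k * bdryTransform q L 1 k t - bdryTransform q L 2 k t)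
      = qhat q L (τ * k) 0 - Complex.exp (-(I * k ^ 3 * (t : ℂ))) * qhat q L (τ * k) t)
    ∧ (let τ : ℂ := Complex.exp (2 * (Real.pi : ℂ) * I / 3);
      (τ ^ 4 * k ^ 2 * bdryTransform q 0 0 k t - I * τ ^ 2 * k * bdryTransform q 0 1 k t
        - bdryTransform q 0 2 k t)
      - Complex.exp (-(I * τ ^ 2 * k * (L : ℂ))) * (τ ^ 4 * k ^ 2 * bdryTransform q L 0 k t
        - I * τ ^ 2 * k * bdryTransform q L 1 k t - bdryTransform q L 2 k t)
      = qhat q L (τ ^ 2 * k) 0 - Complex.exp (-(I * k ^ 3 * (t : ℂ))) * qhat q L (τ ^ 2 * k) t)) := by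
  have hτ : Complex.exp (2 * (Real.pi : ℂ) * I / 3) ^ 3 = 1 := by
    rw [← Complex.exp_nat_mul, ← Complex.exp_two_pi_mul_I]
    congr 1
    push_cast
    ring
  refine ⟨aux_main L T hL q hq hpde k k rfl t ht, ?_, ?_⟩
  · intro τ
    have h3 : τ ^ 3 = 1 := hτ
    have h := aux_main L T hL q hq hpde k (τ * k) (by rw [mul_pow, h3, one_mul]) t ht
    rw [← h]
    ring_nf
  · intro τ
    have h3 : τ ^ 3 = 1 := hτ
    have h := aux_main L T hL q hq hpde k (τ ^ 2 * k)
      (by rw [mul_pow, ← pow_mul, mul_comm 2 3, pow_mul, h3, one_pow, one_mul]) t ht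
    rw [← h]
    ring_nf
end

section
/- Let τ = e^{2πi/3}, let L > 0, α ∈ ℝ, k ∈ ℂ, and let f₁, f₂, g₂ ∈ ℂ be arbitrary. For j = 0,1,2 set aⱼ = −i τ^j k f₁ − f₂, bⱼ = −i τ^j k α f₁ − g₂, and Mⱼ = aⱼ − e^{-iτ^j kL} bⱼ. Then the two identities M₀ A₁(k) − τ² M₁ A₂(k) − M₂ A₃(k) = Δ(k) · (−i k f₁ − f₂) and M₀ B₁(k) − τ² M₁ B₂(k) − M₂ B₃(k) = Δ(k) · (−i k α f₁ − g₂) hold. (Equivalently: the formulas for f̃ and g̃ obtained by solving the 3×3 global-relation system by Cramer's rule are correct.) -/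
open Complex

noncomputable def tau : ℂ := Complex.exp (2 * (Real.pi : ℂ) * I / 3)

noncomputable def Delta (L α : ℝ) (k : ℂ) : ℂ :=
  tau * ((Complex.exp (-(I * k * (L : ℂ))) + tau * Complex.exp (-(I * tau * k * (L : ℂ)))
      + tau ^ 2 * Complex.exp (-(I * tau ^ 2 * k * (L : ℂ))))
    + (α : ℂ) * (Complex.exp (I * k * (L : ℂ)) + tau * Complex.exp (I * tau * k * (L : ℂ))
      + tau ^ 2 * Complex.exp (I * tau ^ 2 * k * (L : ℂ))))

noncomputable def A₁ (L α : ℝ) (k : ℂ) : ℂ :=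
  tau * (α : ℂ) * Complex.exp (I * k * (L : ℂ)) + tau ^ 2 * Complex.exp (-(I * tau * k * (L : ℂ)))
    + Complex.exp (-(I * tau ^ 2 * k * (L : ℂ)))

noncomputable def A₂ (L α : ℝ) (k : ℂ) : ℂ :=
  Complex.exp (-(I * k * (L : ℂ))) - (α : ℂ) * Complex.exp (I * tau * k * (L : ℂ))

noncomputable def A₃ (L α : ℝ) (k : ℂ) : ℂ :=
  Complex.exp (-(I * k * (L : ℂ))) - (α : ℂ) * Complex.exp (I * tau ^ 2 * k * (L : ℂ))

noncomputable def B₁ (L α : ℝ) (k : ℂ) : ℂ :=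
  -tau - (α : ℂ) * Complex.exp (-(I * tau * k * (L : ℂ)))
    - tau ^ 2 * (α : ℂ) * Complex.exp (-(I * tau ^ 2 * k * (L : ℂ)))

noncomputable def B₂ (L α : ℝ) (k : ℂ) : ℂ :=
  1 - (α : ℂ) * Complex.exp (-(I * tau ^ 2 * k * (L : ℂ)))

noncomputable def B₃ (L α : ℝ) (k : ℂ) : ℂ :=
  1 - (α : ℂ) * Complex.exp (-(I * tau * k * (L : ℂ)))

theorem tau_rel : 1 + tau + tau ^ 2 = 0 := by
  have h : IsPrimitiveRoot tau 3 := by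
    have := Complex.isPrimitiveRoot_exp 3 (by norm_num)
    simpa [tau] using this
  have := h.geom_sum_eq_zero (by norm_num)
  simpa [Finset.sum_range_succ] using this

theorem alg_aux (t x y z a f u v w : ℂ) (ht : 1 + t + t ^ 2 = 0) (h : x * y * z = 1) :
    ((-(w * f) - u) - x * (-(w * a * f) - v)) * (t * a * (y * z) + t ^ 2 * y + z)
      - t ^ 2 * ((-(t * w * f) - u) - y * (-(t * w * a * f) - v)) * (x - a * (x * z))
      - ((-(t ^ 2 * w * f) - u) - z * (-(t ^ 2 * w * a * f) - v)) * (x - a * (x * y))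
      = t * ((x + t * y + t ^ 2 * z) + a * (y * z + t * (x * z) + t ^ 2 * (x * y)))
        * (-(w * f) - u) ∧
    ((-(w * f) - u) - x * (-(w * a * f) - v)) * (-t - a * y - t ^ 2 * a * z)
      - t ^ 2 * ((-(t * w * f) - u) - y * (-(t * w * a * f) - v)) * (1 - a * z)
      - ((-(t ^ 2 * w * f) - u) - z * (-(t ^ 2 * w * a * f) - v)) * (1 - a * y)
      = t * ((x + t * y + t ^ 2 * z) + a * (y * z + t * (x * z) + t ^ 2 * (x * y)))
        * (-(w * a * f) - v) := by
  constructor <;> grind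

theorem cramer_solution_identities (L : ℝ) (hL : 0 < L) (α : ℝ) (k : ℂ) (f₁ f₂ g₂ : ℂ) :
    (let a : ℕ → ℂ := fun j => -(I * tau ^ j * k * f₁) - f₂;
     let b : ℕ → ℂ := fun j => -(I * tau ^ j * k * (α : ℂ) * f₁) - g₂;
     let M : ℕ → ℂ := fun j => a j - Complex.exp (-(I * tau ^ j * k * (L : ℂ))) * b j;
     M 0 * A₁ L α k - tau ^ 2 * M 1 * A₂ L α k - M 2 * A₃ L α k
        = Delta L α k * (-(I * k * f₁) - f₂)
      ∧ M 0 * B₁ L α k - tau ^ 2 * M 1 * B₂ L α k - M 2 * B₃ L α k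
        = Delta L α k * (-(I * k * (α : ℂ) * f₁) - g₂)) := by
  intro a b M
  have ht := tau_rel
  have h : Complex.exp (-(I * k * (L : ℂ))) * Complex.exp (-(I * tau * k * (L : ℂ)))
      * Complex.exp (-(I * tau ^ 2 * k * (L : ℂ))) = 1 := by
    rw [← Complex.exp_add, ← Complex.exp_add, ← Complex.exp_zero]
    congr 1
    linear_combination (-(I * k * (L : ℂ))) * ht
  have e0 : Complex.exp (I * k * (L : ℂ)) = Complex.exp (-(I * tau * k * (L : ℂ)))
      * Complex.exp (-(I * tau ^ 2 * k * (L : ℂ))) := by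
    rw [← Complex.exp_add]
    congr 1
    linear_combination (I * k * (L : ℂ)) * ht
  have e1 : Complex.exp (I * tau * k * (L : ℂ)) = Complex.exp (-(I * k * (L : ℂ)))
      * Complex.exp (-(I * tau ^ 2 * k * (L : ℂ))) := by
    rw [← Complex.exp_add]
    congr 1
    linear_combination (I * k * (L : ℂ)) * ht
  have e2 : Complex.exp (I * tau ^ 2 * k * (L : ℂ)) = Complex.exp (-(I * k * (L : ℂ)))
      * Complex.exp (-(I * tau * k * (L : ℂ))) := by
    rw [← Complex.exp_add]
    congr 1
    linear_combination (I * k * (L : ℂ)) * ht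
  have key := alg_aux tau _ _ _ (α : ℂ) f₁ f₂ g₂ (I * k) ht h
  simp only [M, a, b, A₁, A₂, A₃, B₁, B₂, B₃, Delta, e0, e1, e2, pow_zero, pow_one, mul_one]
  refine ⟨?_, ?_⟩
  · linear_combination key.1
  · linear_combination key.2
end

section
/- (Proposition 1.) Let τ = e^{2πi/3}, L > 0, α ∈ ℝ, and let Q, F₀, G₀ : ℂ → ℂ be arbitrary functions with F₀(τ k) = F₀(k) and G₀(τ k) = G₀(k) for all k ∈ ℂ. Define N(k) = Q(k) − k² F₀(k) + e^{-ikL} k² G₀(k), and define ζ⁺(k) = k² F₀(k) Δ(k) + [ N(k) A₁(k) − τ² N(τ k) A₂(k) − N(τ² k) A₃(k) ] and ζ⁻(k) = k² G₀(k) Δ(k) + [ N(k) B₁(k) − τ² N(τ k) B₂(k) − N(τ² k) B₃(k) ]. Then for every k ∈ ℂ: ζ⁺(k) − e^{-ikL} ζ⁻(k) = Q(k) Δ(k). -/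
open Complex

theorem zeta_global_relation (L : ℝ) (hL : 0 < L) (α : ℝ) (Q F₀ G₀ : ℂ → ℂ)
    (hF : ∀ k : ℂ, F₀ (tau * k) = F₀ k) (hG : ∀ k : ℂ, G₀ (tau * k) = G₀ k) :
    ∀ k : ℂ,
      (let N : ℂ → ℂ := fun κ =>
        Q κ - κ ^ 2 * F₀ κ + Complex.exp (-(I * κ * (L : ℂ))) * κ ^ 2 * G₀ κ;
      let ζp : ℂ → ℂ := fun κ => κ ^ 2 * F₀ κ * Delta L α κ
        + (N κ * A₁ L α κ - tau ^ 2 * N (tau * κ) * A₂ L α κ - N (tau ^ 2 * κ) * A₃ L α κ);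
      let ζm : ℂ → ℂ := fun κ => κ ^ 2 * G₀ κ * Delta L α κ
        + (N κ * B₁ L α κ - tau ^ 2 * N (tau * κ) * B₂ L α κ - N (tau ^ 2 * κ) * B₃ L α κ);
      ζp k - Complex.exp (-(I * k * (L : ℂ))) * ζm k = Q k * Delta L α k) := by
  intro k
  have h3 : tau ^ 3 = 1 := by
    unfold tau
    rw [← Complex.exp_nat_mul, ← Complex.exp_two_pi_mul_I]
    congr 1
    push_cast
    ring
  have hne : tau ≠ 1 := by
    intro h
    unfold tau at h
    rw [Complex.exp_eq_one_iff] at h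
    obtain ⟨n, hn⟩ := h
    have h2 : (2 * (Real.pi : ℂ) * I) ≠ 0 := Complex.two_pi_I_ne_zero
    have h4 : (2 * (Real.pi : ℂ) * I) * (3 * (n : ℂ) - 1) = 0 := by linear_combination -3 * hn
    have h5 : 3 * (n : ℂ) - 1 = 0 := (mul_eq_zero.mp h4).resolve_left h2
    have h6 : 3 * n - 1 = 0 := by exact_mod_cast h5
    omega
  have hs : 1 + tau + tau ^ 2 = 0 := by
    have h : (tau - 1) * (1 + tau + tau ^ 2) = 0 := by linear_combination h3
    exact (mul_eq_zero.mp h).resolve_left (sub_ne_zero.mpr hne)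
  have p0 : Complex.exp (I * k * (L : ℂ)) = Complex.exp (-(I * tau * k * (L : ℂ)))
      * Complex.exp (-(I * tau ^ 2 * k * (L : ℂ))) := by
    rw [← Complex.exp_add]
    congr 1
    linear_combination (I * k * (L : ℂ)) * hs
  have p1 : Complex.exp (I * tau * k * (L : ℂ)) = Complex.exp (-(I * k * (L : ℂ)))
      * Complex.exp (-(I * tau ^ 2 * k * (L : ℂ))) := by
    rw [← Complex.exp_add]
    congr 1
    linear_combination (I * k * (L : ℂ)) * hs
  have p2 : Complex.exp (I * tau ^ 2 * k * (L : ℂ)) = Complex.exp (-(I * k * (L : ℂ)))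
      * Complex.exp (-(I * tau * k * (L : ℂ))) := by
    rw [← Complex.exp_add]
    congr 1
    linear_combination (I * k * (L : ℂ)) * hs
  have a1 : A₁ L α k - Complex.exp (-(I * k * (L : ℂ))) * B₁ L α k = Delta L α k := by
    unfold A₁ B₁ Delta
    rw [p0, p1, p2]
    generalize Complex.exp (-(I * k * (L : ℂ))) = x
    generalize Complex.exp (-(I * tau * k * (L : ℂ))) = y
    generalize Complex.exp (-(I * tau ^ 2 * k * (L : ℂ))) = z
    linear_combination (-z - (α : ℂ) * x * y) * h3
  have a2 : A₂ L α k - Complex.exp (-(I * k * (L : ℂ))) * B₂ L α k = 0 := by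
    unfold A₂ B₂
    rw [p1]
    ring
  have a3 : A₃ L α k - Complex.exp (-(I * k * (L : ℂ))) * B₃ L α k = 0 := by
    unfold A₃ B₃
    rw [p2]
    ring
  intro N ζp ζm
  have hN : N k = Q k - k ^ 2 * F₀ k + Complex.exp (-(I * k * (L : ℂ))) * k ^ 2 * G₀ k := rfl
  change (k ^ 2 * F₀ k * Delta L α k
        + (N k * A₁ L α k - tau ^ 2 * N (tau * k) * A₂ L α k - N (tau ^ 2 * k) * A₃ L α k))
      - Complex.exp (-(I * k * (L : ℂ))) * (k ^ 2 * G₀ k * Delta L α k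
        + (N k * B₁ L α k - tau ^ 2 * N (tau * k) * B₂ L α k - N (tau ^ 2 * k) * B₃ L α k))
      = Q k * Delta L α k
  clear_value N
  linear_combination N k * a1 - tau ^ 2 * N (tau * k) * a2 - N (tau ^ 2 * k) * a3
    + Delta L α k * hN
end

section
/- Let L > 0, T > 0, α ∈ ℝ with |α| = 1, and let q : ℝ × ℝ → ℝ be smooth (C³ in x, C¹ in t, with continuous mixed derivatives), satisfy q_t + q_{xxx} = 0 at every point of [0,L] × [0,T], and satisfy the boundary conditions q(0,t) = 0, q(L,t) = 0 and q_x(L,t) = α q_x(0,t) for all t ∈ [0,T]. Then the L² energy is conserved: ∫₀ᴸ q(x,t)² dx = ∫₀ᴸ q(x,0)² dx for all t ∈ [0,T]. -/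
theorem energy_conservation (L T α : ℝ) (hL : 0 < L) (hT : 0 < T) (hα : |α| = 1)
    (q : ℝ × ℝ → ℝ) (hq : ContDiff ℝ (⊤ : ℕ∞) q)
    (hpde : ∀ x ∈ Set.Icc (0 : ℝ) L, ∀ s ∈ Set.Icc (0 : ℝ) T,
      deriv (fun s' : ℝ => q (x, s')) s
        + deriv (deriv (deriv (fun z : ℝ => q (z, s)))) x = 0)
    (hbc0 : ∀ s ∈ Set.Icc (0 : ℝ) T, q (0, s) = 0)
    (hbcL : ∀ s ∈ Set.Icc (0 : ℝ) T, q (L, s) = 0)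
    (hbcx : ∀ s ∈ Set.Icc (0 : ℝ) T,
      deriv (fun z : ℝ => q (z, s)) L = α * deriv (fun z : ℝ => q (z, s)) 0) :
    ∀ t ∈ Set.Icc (0 : ℝ) T,
      (∫ x in (0:ℝ)..L, (q (x, t)) ^ 2) = ∫ x in (0:ℝ)..L, (q (x, 0)) ^ 2 := by
  intro t ht
  have hqc : Continuous q := hq.continuous
  have hqd : Differentiable ℝ q := hq.differentiable (by simp)
  -- time derivative
  have hdt : ∀ x s, HasDerivAt (fun s' : ℝ => q (x, s')) (fderiv ℝ q (x, s) (0, 1)) s := by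
    intro x s
    exact (hqd (x, s)).hasFDerivAt.comp_hasDerivAt s
      ((hasDerivAt_const s x).prodMk (hasDerivAt_id s))
  have hfc : Continuous (fun p : ℝ × ℝ => fderiv ℝ q p (0, 1)) :=
    (hq.continuous_fderiv (by simp)).clm_apply continuous_const
  have hGc : Continuous (fun p : ℝ × ℝ => 2 * q p * fderiv ℝ q p (0, 1)) :=
    (continuous_const.mul hqc).mul hfc
  have hinner : ∀ x, q (x, t) ^ 2 - q (x, 0) ^ 2
      = ∫ s in (0:ℝ)..t, 2 * q (x, s) * fderiv ℝ q (x, s) (0, 1) := by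
    intro x
    symm
    apply intervalIntegral.integral_eq_sub_of_hasDerivAt (f := fun s => q (x, s) ^ 2)
    · intro s _
      have := (hdt x s).pow 2
      refine this.congr_deriv ?_
      norm_num
    · exact (hGc.comp (by fun_prop : Continuous fun s : ℝ => (x, s))).intervalIntegrable _ _
  have hspace : ∀ s ∈ Set.Icc (0:ℝ) T,
      ∫ x in (0:ℝ)..L, 2 * q (x, s) * fderiv ℝ q (x, s) (0, 1) = 0 := by
    intro s hs
    set f : ℝ → ℝ := fun z => q (z, s) with hf
    have hf0 : ContDiff ℝ 3 f :=
      (contDiff_infty.1 hq 3).comp (contDiff_id.prodMk contDiff_const)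
    have hf1 : ContDiff ℝ 2 (deriv f) :=
      ((contDiff_succ_iff_deriv (n := 2)).1 (by norm_num; exact hf0)).2.2
    have hf2 : ContDiff ℝ 1 (deriv (deriv f)) :=
      ((contDiff_succ_iff_deriv (n := 1)).1 (by norm_num; exact hf1)).2.2
    have d0 : ∀ x, HasDerivAt f (deriv f x) x := fun x =>
      (hf0.differentiable (by norm_num) x).hasDerivAt
    have d1 : ∀ x, HasDerivAt (deriv f) (deriv (deriv f) x) x := fun x =>
      (hf1.differentiable (by norm_num) x).hasDerivAt
    have d2 : ∀ x, HasDerivAt (deriv (deriv f)) (deriv (deriv (deriv f)) x) x := fun x =>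
      (hf2.differentiable (by norm_num) x).hasDerivAt
    rw [intervalIntegral.integral_eq_sub_of_hasDerivAt
      (f := fun x => deriv f x ^ 2 - 2 * (f x * deriv (deriv f) x))]
    · have h0 : f 0 = 0 := hbc0 s hs
      have h1 : f L = 0 := hbcL s hs
      have h2 : deriv f L = α * deriv f 0 := hbcx s hs
      have h3 : α ^ 2 = 1 := by rw [← sq_abs, hα]; norm_num
      simp only [h0, h1, h2, mul_pow, h3]
      ring
    · intro x hx
      rw [Set.uIcc_of_le hL.le] at hx
      have hp := hpde x hx s hs
      rw [(hdt x s).deriv] at hp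
      have := ((d1 x).pow 2).sub (((d0 x).mul (d2 x)).const_mul 2)
      refine this.congr_deriv ?_
      have e : fderiv ℝ q (x, s) (0, 1) = - deriv (deriv (deriv f)) x := by linarith
      rw [e]
      simp only [hf]
      push_cast
      ring
    · exact (hGc.comp (by fun_prop : Continuous fun x : ℝ => (x, s))).intervalIntegrable _ _
  have hi : ∀ u, IntervalIntegrable (fun x => q (x, u) ^ 2) MeasureTheory.volume 0 L := fun u =>
    ((hqc.comp (by fun_prop : Continuous fun x : ℝ => (x, u))).pow 2).intervalIntegrable _ _
  rw [← sub_eq_zero, ← intervalIntegral.integral_sub (hi t) (hi 0)]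
  simp only [hinner]
  rw [MeasureTheory.intervalIntegral_intervalIntegral_swap]
  · rw [intervalIntegral.integral_congr (g := fun _ => (0:ℝ))]
    · simp
    · intro s hs
      rw [Set.uIcc_of_le ht.1] at hs
      exact hspace s ⟨hs.1, hs.2.trans ht.2⟩
  · refine MeasureTheory.IntegrableOn.mono_set (t := Set.uIcc 0 L ×ˢ Set.uIcc 0 t) ?_
      (Set.prod_mono Set.uIoc_subset_uIcc Set.uIoc_subset_uIcc)
    exact hGc.continuousOn.integrableOn_compact (isCompact_uIcc.prod isCompact_uIcc)
end

section
/- Let L > 0, T > 0, α ∈ ℝ with |α| < 1, and let q : ℝ × ℝ → ℝ be smooth (C³ in x, C¹ in t, with continuous mixed derivatives), satisfy q_t + q_{xxx} = 0 at every point of [0,L] × [0,T], and satisfy the boundary conditions q(0,t) = 0, q(L,t) = 0 and q_x(L,t) = α q_x(0,t) for all t ∈ [0,T]. Then the L² energy decreases in time: the function t ↦ ∫₀ᴸ q(x,t)² dx is nonincreasing on [0,T], with d/dt ∫₀ᴸ q(x,t)² dx = (α² − 1) q_x(0,t)² ≤ 0. -/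
theorem energy_hasDerivAt (L : ℝ) (q : ℝ × ℝ → ℝ) (hq : ContDiff ℝ (⊤ : ℕ∞) q) (t : ℝ) :
    HasDerivAt (fun s : ℝ => ∫ x in (0:ℝ)..L, (q (x, s)) ^ 2)
      (∫ x in (0:ℝ)..L, 2 * q (x, t) * deriv (fun s' : ℝ => q (x, s')) t) t := by
  have hd : ∀ x s : ℝ, HasDerivAt (fun s' : ℝ => q (x, s')) (fderiv ℝ q (x, s) (0, 1)) s := by
    intro x s
    have h1 : HasFDerivAt q (fderiv ℝ q (x, s)) (x, s) :=
      (hq.differentiable (by simp) (x, s)).hasFDerivAt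
    have h2 : HasDerivAt (fun s' : ℝ => (x, s')) ((0 : ℝ), (1 : ℝ)) s :=
      (hasDerivAt_const s x).prodMk (hasDerivAt_id s)
    exact h1.comp_hasDerivAt s h2
  have hqc : Continuous q := hq.continuous
  have hfc : Continuous (fderiv ℝ q) := hq.continuous_fderiv (by simp)
  have hc : Continuous (fun p : ℝ × ℝ => 2 * q p * fderiv ℝ q p (0, 1)) := by fun_prop
  have hK : IsCompact (Set.uIcc 0 L ×ˢ Set.Icc (t - 1) (t + 1)) :=
    isCompact_uIcc.prod isCompact_Icc
  obtain ⟨C, hC⟩ := hK.exists_bound_of_continuousOn hc.continuousOn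
  have key := (intervalIntegral.hasDerivAt_integral_of_dominated_loc_of_deriv_le
    (μ := MeasureTheory.volume) (a := 0) (b := L)
    (F := fun s x => (q (x, s)) ^ 2)
    (F' := fun s x => 2 * q (x, s) * fderiv ℝ q (x, s) (0, 1))
    (x₀ := t) (s := Set.Icc (t - 1) (t + 1)) (bound := fun _ => C)
    (Icc_mem_nhds (by linarith) (by linarith))
    (Filter.Eventually.of_forall fun s =>
      (show Continuous (fun x => (q (x, s)) ^ 2) by fun_prop).aestronglyMeasurable)
    ((show Continuous (fun x => (q (x, t)) ^ 2) by fun_prop).intervalIntegrable _ _)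
    ((show Continuous (fun x => 2 * q (x, t) * fderiv ℝ q (x, t) (0, 1)) by
      fun_prop).aestronglyMeasurable)
    (Filter.Eventually.of_forall fun x hx s hs =>
      hC (x, s) ⟨Set.uIoc_subset_uIcc hx, hs⟩)
    (by simp)
    (Filter.Eventually.of_forall fun x hx s hs => by
      have := (hd x s).fun_pow 2
      simpa using this)).2
  have e : ∀ x, deriv (fun s' : ℝ => q (x, s')) t = fderiv ℝ q (x, t) (0, 1) :=
    fun x => (hd x t).deriv
  simp only [e]
  exact key

theorem space_integral (L : ℝ) (f : ℝ → ℝ) (hf : ContDiff ℝ (⊤ : ℕ∞) f)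
    (h0 : f 0 = 0) (hL : f L = 0) :
    ∫ x in (0:ℝ)..L, 2 * f x * (- deriv (deriv (deriv f)) x)
      = (deriv f L) ^ 2 - (deriv f 0) ^ 2 := by
  have h1 : ContDiff ℝ (⊤ : ℕ∞) (deriv f) := (contDiff_infty_iff_deriv.1 hf).2
  have h2 : ContDiff ℝ (⊤ : ℕ∞) (deriv (deriv f)) := (contDiff_infty_iff_deriv.1 h1).2
  have h3 : ContDiff ℝ (⊤ : ℕ∞) (deriv (deriv (deriv f))) := (contDiff_infty_iff_deriv.1 h2).2
  have c0 := hf.continuous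
  have c3 := h3.continuous
  have H := intervalIntegral.integral_eq_sub_of_hasDerivAt (a := 0) (b := L)
    (f := fun x => (deriv f x) ^ 2 - 2 * (f x * deriv (deriv f) x))
    (f' := fun x => 2 * f x * (- deriv (deriv (deriv f)) x))
    (fun x _ => by
      have d0 := (hf.differentiable (by simp) x).hasDerivAt
      have d1 := (h1.differentiable (by simp) x).hasDerivAt
      have d2 := (h2.differentiable (by simp) x).hasDerivAt
      convert (d1.pow 2).sub ((d0.mul d2).const_mul 2) using 1
      · rfl
      · push_cast
        ring)
    ((show Continuous (fun x => 2 * f x * (- deriv (deriv (deriv f)) x)) by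
      fun_prop).intervalIntegrable _ _)
  rw [H]
  simp [h0, hL]

theorem energy_decay (L T α : ℝ) (hL : 0 < L) (hT : 0 < T) (hα : |α| < 1)
    (q : ℝ × ℝ → ℝ) (hq : ContDiff ℝ (⊤ : ℕ∞) q)
    (hpde : ∀ x ∈ Set.Icc (0 : ℝ) L, ∀ s ∈ Set.Icc (0 : ℝ) T,
      deriv (fun s' : ℝ => q (x, s')) s
        + deriv (deriv (deriv (fun z : ℝ => q (z, s)))) x = 0)
    (hbc0 : ∀ s ∈ Set.Icc (0 : ℝ) T, q (0, s) = 0)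
    (hbcL : ∀ s ∈ Set.Icc (0 : ℝ) T, q (L, s) = 0)
    (hbcx : ∀ s ∈ Set.Icc (0 : ℝ) T,
      deriv (fun z : ℝ => q (z, s)) L = α * deriv (fun z : ℝ => q (z, s)) 0) :
    AntitoneOn (fun t : ℝ => ∫ x in (0:ℝ)..L, (q (x, t)) ^ 2) (Set.Icc (0 : ℝ) T)
      ∧ ∀ t ∈ Set.Ioo (0 : ℝ) T,
          deriv (fun s : ℝ => ∫ x in (0:ℝ)..L, (q (x, s)) ^ 2) t
              = (α ^ 2 - 1) * (deriv (fun z : ℝ => q (z, t)) 0) ^ 2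
            ∧ (α ^ 2 - 1) * (deriv (fun z : ℝ => q (z, t)) 0) ^ 2 ≤ 0 := by
  have hα2 : α ^ 2 - 1 ≤ 0 := by
    have := (sq_lt_one_iff_abs_lt_one α).2 hα
    linarith
  have hneg : ∀ t : ℝ, (α ^ 2 - 1) * (deriv (fun z : ℝ => q (z, t)) 0) ^ 2 ≤ 0 :=
    fun t => mul_nonpos_of_nonpos_of_nonneg hα2 (sq_nonneg _)
  have hder : ∀ t ∈ Set.Icc (0 : ℝ) T,
      deriv (fun s : ℝ => ∫ x in (0:ℝ)..L, (q (x, s)) ^ 2) t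
        = (α ^ 2 - 1) * (deriv (fun z : ℝ => q (z, t)) 0) ^ 2 := by
    intro t ht
    rw [(energy_hasDerivAt L q hq t).deriv]
    have hs := space_integral L (fun z => q (z, t)) (hq.comp (by fun_prop))
      (hbc0 t ht) (hbcL t ht)
    rw [hbcx t ht] at hs
    have hcongr : ∫ x in (0:ℝ)..L, 2 * q (x, t) * deriv (fun s' : ℝ => q (x, s')) t
        = ∫ x in (0:ℝ)..L, 2 * q (x, t) * (- deriv (deriv (deriv (fun z => q (z, t)))) x) := by
      apply intervalIntegral.integral_congr
      intro x hx
      rw [Set.uIcc_of_le hL.le] at hx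
      have := hpde x hx t ht
      have e : deriv (fun s' : ℝ => q (x, s')) t
        = - deriv (deriv (deriv (fun z => q (z, t)))) x := by linarith
      simp only [e]
    rw [hcongr, hs]
    ring
  refine ⟨?_, fun t ht => ⟨hder t (Set.Ioo_subset_Icc_self ht), hneg t⟩⟩
  apply antitoneOn_of_deriv_nonpos (convex_Icc 0 T)
  · exact fun t _ => (energy_hasDerivAt L q hq t).continuousAt.continuousWithinAt
  · exact fun t _ => (energy_hasDerivAt L q hq t).differentiableAt.differentiableWithinAt
  · intro t ht
    rw [hder t (interior_subset ht)]
    exact hneg t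
end
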